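/- arXiv:1411.7713 — 6 statements merged into one kernel-verified Lean document; each statement's English description precedes it below -/
import Mathlib

section
/- Let X be a measurable space, d : X×X → [0,∞) measurable, symmetric, with d(x,x)=0, P a Markov kernel on X, and K a Markov kernel on X×X whose first and second marginals at (x,y) are P(x,·) and P(y,·). Let s ∈ (0,1], f : X → ℝ measurable with |f(x)−f(y)| ≤ L d(x,y)^s for all x,y. Suppose (Kⁿ d^{2s})(x,y) ≤ c rⁿ d(x,y)^{2s} for all n ≥ 1 and all x,y, with c > 0, r ∈ (0,1), and that M := sup_n ∫ d(x₀,z)^{2s} Pⁿ(x₀,dz) < ∞ for some x₀ ∈ X. For positive integers a' < a define the probability measure μ on X×X by μ := ∫ K^{a'}((u, x₀), ·) P^{a−a'}(x₀, du). Then ∫_{X×X} (f(u) − f(l))² μ(du,dl) ≤ c L² M r^{a'}. -/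
open MeasureTheory ProbabilityTheory

/-- `n`-fold composition of a Markov kernel with itself (`kpow K n = Kⁿ`). -/
noncomputable def kpow {X : Type*} [MeasurableSpace X] (K : Kernel X X) : ℕ → Kernel X X
  | 0 => Kernel.id
  | n + 1 => (kpow K n) ∘ₖ K

/-- The key decay estimate `‖Δᵢ‖₂² ≤ c L² M r^{a'}` for the coupled-contraction construction:
`μ` is the time-0 law of a pair of chains, the first started at `x₀` and run for `a` steps,
the second started at `x₀` and coupled to the first through `K` during the final `a'` steps. -/
theorem stmt_8
    {X : Type*} [MeasurableSpace X]
    -- a distance-like function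
    (d : X → X → ℝ)
    (hd_nonneg : ∀ x z, 0 ≤ d x z) (hd_symm : ∀ x z, d x z = d z x)
    (hd_refl : ∀ x, d x x = 0)
    (P : Kernel X X) [IsMarkovKernel P]
    (K : Kernel (X × X) (X × X)) [IsMarkovKernel K]
    (hK1 : ∀ x z : X, (K (x, z)).map Prod.fst = P x)
    (hK2 : ∀ x z : X, (K (x, z)).map Prod.snd = P z)
    (s : ℝ) (hs0 : 0 < s) (hs1 : s ≤ 1)
    (f : X → ℝ) (hfmeas : Measurable f) (L : ℝ)
    (hf : ∀ x z, |f x - f z| ≤ L * d x z ^ s)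
    (c r : ℝ) (hc : 0 < c) (hr0 : 0 < r) (hr1 : r < 1)
    (hcontr : ∀ n : ℕ, 1 ≤ n → ∀ x z : X,
      ∫⁻ q, ENNReal.ofReal (d q.1 q.2 ^ (2 * s)) ∂(kpow K n (x, z))
        ≤ ENNReal.ofReal (c * r ^ n * d x z ^ (2 * s)))
    (x₀ : X) (M : ℝ) (hM0 : 0 ≤ M)
    (hM : ∀ n : ℕ,
      ∫⁻ z, ENNReal.ofReal (d x₀ z ^ (2 * s)) ∂(kpow P n x₀) ≤ ENNReal.ofReal M)
    (a' a : ℕ) (ha' : 0 < a') (haa : a' < a) :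
    ∫ q, (f q.1 - f q.2) ^ 2
        ∂((kpow P (a - a') x₀).bind (fun u => kpow K a' (u, x₀)))
      ≤ c * L ^ 2 * M * r ^ a' := by
  have hsq : ∀ x z, (f x - f z) ^ 2 ≤ L ^ 2 * d x z ^ (2 * s) := by
    intro x z
    have h := pow_le_pow_left₀ (abs_nonneg _) (hf x z) 2
    rwa [sq_abs, mul_pow, ← Real.rpow_mul_natCast (hd_nonneg x z), Nat.cast_ofNat,
      mul_comm s 2] at h
  have hmeas : Measurable fun q : X × X => (f q.1 - f q.2) ^ 2 := by fun_prop
  have hker : Measurable fun u : X => kpow K a' (u, x₀) :=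
    (kpow K a').measurable.comp (by fun_prop)
  have hcr : 0 ≤ L ^ 2 * (c * r ^ a') := by positivity
  rw [integral_eq_lintegral_of_nonneg_ae (.of_forall fun _ => sq_nonneg _)
    hmeas.aestronglyMeasurable]
  refine ENNReal.toReal_le_of_le_ofReal (by positivity) ?_
  rw [Measure.lintegral_bind hker.aemeasurable hmeas.ennreal_ofReal.aemeasurable]
  have hinner : ∀ u, ∫⁻ q, ENNReal.ofReal ((f q.1 - f q.2) ^ 2) ∂(kpow K a' (u, x₀))
      ≤ ENNReal.ofReal (L ^ 2 * (c * r ^ a')) * ENNReal.ofReal (d x₀ u ^ (2 * s)) := by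
    intro u
    calc ∫⁻ q, ENNReal.ofReal ((f q.1 - f q.2) ^ 2) ∂(kpow K a' (u, x₀))
        ≤ ∫⁻ q, ENNReal.ofReal (L ^ 2) * ENNReal.ofReal (d q.1 q.2 ^ (2 * s))
            ∂(kpow K a' (u, x₀)) := by
          refine lintegral_mono fun q => ?_
          rw [← ENNReal.ofReal_mul (sq_nonneg L)]
          exact ENNReal.ofReal_le_ofReal (hsq q.1 q.2)
      _ = ENNReal.ofReal (L ^ 2) * ∫⁻ q, ENNReal.ofReal (d q.1 q.2 ^ (2 * s))
            ∂(kpow K a' (u, x₀)) := lintegral_const_mul' _ _ ENNReal.ofReal_ne_top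
      _ ≤ ENNReal.ofReal (L ^ 2) * ENNReal.ofReal (c * r ^ a' * d u x₀ ^ (2 * s)) := by
          gcongr
          exact hcontr a' ha' u x₀
      _ = _ := by
          rw [← ENNReal.ofReal_mul (sq_nonneg L), ← ENNReal.ofReal_mul hcr, hd_symm u x₀,
            mul_assoc (L ^ 2)]
  calc _ ≤ ∫⁻ u, ENNReal.ofReal (L ^ 2 * (c * r ^ a')) * ENNReal.ofReal (d x₀ u ^ (2 * s))
          ∂(kpow P (a - a') x₀) := lintegral_mono hinner
    _ = ENNReal.ofReal (L ^ 2 * (c * r ^ a')) * ∫⁻ u, ENNReal.ofReal (d x₀ u ^ (2 * s))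
          ∂(kpow P (a - a') x₀) := lintegral_const_mul' _ _ ENNReal.ofReal_ne_top
    _ ≤ ENNReal.ofReal (L ^ 2 * (c * r ^ a')) * ENNReal.ofReal M := by
        gcongr
        exact hM _
    _ = ENNReal.ofReal (c * L ^ 2 * M * r ^ a') := by
        rw [← ENNReal.ofReal_mul hcr]
        congr 1
        ring
end

section
/- Let (u_k*)_{k≥1} be a positive sequence decreasing to 0, let X := ∏_{k=1}^∞ [−u_k*, u_k*], and let Π_j : X → X denote the projection setting all coordinates beyond the j-th to zero. Fix y ∈ ℝ^d, and let G and G_j : X → ℝ^d (j ≥ 1) be maps with G_j(u) = G_j(Π_j u) for all u, sup_{u∈X} ‖G_j(u) − G(u)‖_{ℝ^d} ≤ C₁ j^{−β} for some β > 0, and sup_{u∈X} ‖G(u)‖_{ℝ^d} ≤ C₂. Define the independence-sampler acceptance probabilities α_j(x,z) := 1 ∧ exp( ½‖y − G_j(x)‖²_{ℝ^d} − ½‖y − G_j(z)‖²_{ℝ^d} ). Then there exists a constant C₃ > 0, depending only on C₁, C₂, ‖y‖ and β, such that for all positive integers j ≤ j′ and all x, z ∈ X: | α_{j′}(x, z)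 − α_j(Π_j x, Π_j z) | ≤ C₃ j^{−β}. -/
open MeasureTheory

/-- The independence-sampler acceptance probability
`α(x,z) = 1 ∧ exp(½‖y − G x‖² − ½‖y − G z‖²)`. -/
noncomputable def accept {dm : ℕ} (y : EuclideanSpace ℝ (Fin dm))
    (G : (ℕ → ℝ) → EuclideanSpace ℝ (Fin dm)) (x z : ℕ → ℝ) : ℝ :=
  min 1 (Real.exp (‖y - G x‖ ^ 2 / 2 - ‖y - G z‖ ^ 2 / 2))

theorem abs_min_one_exp_sub_le (a b : ℝ) :
    |min 1 (Real.exp a) - min 1 (Real.exp b)| ≤ |a - b| := by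
  wlog h : b ≤ a generalizing a b
  · rw [abs_sub_comm, abs_sub_comm a]
    exact this b a (le_of_not_ge h)
  have hmono : min 1 (Real.exp b) ≤ min 1 (Real.exp a) :=
    min_le_min_left 1 (Real.exp_le_exp.2 h)
  rw [abs_of_nonneg (sub_nonneg.2 hmono), abs_of_nonneg (sub_nonneg.2 h)]
  rcases le_total 0 b with hb | hb
  · rw [min_eq_left (Real.one_le_exp hb)]
    linarith [min_le_left 1 (Real.exp a)]
  · rw [min_eq_right (Real.exp_le_one_iff.2 hb)]
    have hle : min 1 (Real.exp a) * (1 - (a - b)) ≤ Real.exp b := by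
      calc min 1 (Real.exp a) * (1 - (a - b))
          ≤ min 1 (Real.exp a) * Real.exp (b - a) := by
            gcongr
            linarith [Real.add_one_le_exp (b - a)]
        _ ≤ Real.exp a * Real.exp (b - a) := by
            gcongr
            exact min_le_right _ _
        _ = Real.exp b := by rw [← Real.exp_add]; congr 1; ring
    nlinarith [mul_le_mul_of_nonneg_right (min_le_left 1 (Real.exp a)) (sub_nonneg.2 h)]

theorem abs_half_norm_sq_sub_le {E : Type*} [SeminormedAddCommGroup E] {a b : E} {M ε : ℝ}
    (ha : ‖a‖ ≤ M) (hb : ‖b‖ ≤ M) (hab : ‖a - b‖ ≤ ε) :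
    |‖a‖ ^ 2 / 2 - ‖b‖ ^ 2 / 2| ≤ M * ε := by
  have hsum : (‖a‖ + ‖b‖) / 2 ≤ M := by linarith
  have hM : 0 ≤ M := (norm_nonneg a).trans ha
  calc |‖a‖ ^ 2 / 2 - ‖b‖ ^ 2 / 2| = (‖a‖ + ‖b‖) / 2 * |‖a‖ - ‖b‖| := by
        rw [show ‖a‖ ^ 2 / 2 - ‖b‖ ^ 2 / 2 = (‖a‖ + ‖b‖) / 2 * (‖a‖ - ‖b‖) by ring, abs_mul,
          abs_of_nonneg (by positivity)]
    _ ≤ M * ε := mul_le_mul hsum ((abs_norm_sub_norm_le a b).trans hab) (abs_nonneg _) hM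

/-- Acceptance probabilities of independence samplers at two discretisation levels differ by
`O(j^{-β})`, uniformly over the state space `X = ∏_k [−u_k*, u_k*]`, with a constant
depending only on `C₁`, `C₂`, `‖y‖` and `β`. -/
theorem stmt_11 (dm : ℕ) (y : EuclideanSpace ℝ (Fin dm)) (β C₁ C₂ : ℝ)
    (hβ : 0 < β) (hC₁ : 0 ≤ C₁) (hC₂ : 0 ≤ C₂) :
    ∃ C₃ : ℝ, 0 < C₃ ∧
      ∀ (ustar : ℕ → ℝ), (∀ k, 0 < ustar k) → Antitone ustar →
        Filter.Tendsto ustar Filter.atTop (nhds 0) →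
      ∀ (G : (ℕ → ℝ) → EuclideanSpace ℝ (Fin dm))
        (Gj : ℕ → (ℕ → ℝ) → EuclideanSpace ℝ (Fin dm)),
        -- `G_j` depends on `u` only through the projection `Π_j u`
        (∀ j : ℕ, ∀ u : ℕ → ℝ, (∀ k, |u k| ≤ ustar k) →
          Gj j u = Gj j (fun k => if k < j then u k else 0)) →
        -- `sup_{u ∈ X} ‖G_j(u) − G(u)‖ ≤ C₁ j^{-β}`
        (∀ j : ℕ, 1 ≤ j → ∀ u : ℕ → ℝ, (∀ k, |u k| ≤ ustar k) →
          ‖Gj j u - G u‖ ≤ C₁ * (j : ℝ) ^ (-β)) →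
        -- `sup_{u ∈ X} ‖G(u)‖ ≤ C₂`
        (∀ u : ℕ → ℝ, (∀ k, |u k| ≤ ustar k) → ‖G u‖ ≤ C₂) →
      ∀ j j' : ℕ, 1 ≤ j → j ≤ j' →
      ∀ x z : ℕ → ℝ, (∀ k, |x k| ≤ ustar k) → (∀ k, |z k| ≤ ustar k) →
        |accept y (Gj j') x z
            - accept y (Gj j) (fun k => if k < j then x k else 0)
                (fun k => if k < j then z k else 0)|
          ≤ C₃ * (j : ℝ) ^ (-β) := by
  refine ⟨4 * (‖y‖ + C₁ + C₂) * C₁ + 1, by positivity, ?_⟩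
  intro ustar _ _ _ G Gj hproj happrox hbound j j' hj hjj' x z hx hz
  set r : ℝ := (j : ℝ) ^ (-β)
  have hj0 : (0 : ℝ) < j := by exact_mod_cast hj
  have hr0 : 0 ≤ r := Real.rpow_nonneg hj0.le _
  have hr1 : r ≤ 1 := Real.rpow_le_one_of_one_le_of_nonpos (by exact_mod_cast hj) (by linarith)
  have herr : ∀ i, j ≤ i → ∀ u : ℕ → ℝ, (∀ k, |u k| ≤ ustar k) → ‖Gj i u - G u‖ ≤ C₁ * r := by
    intro i hi u hu
    refine (happrox i (hj.trans hi) u hu).trans (mul_le_mul_of_nonneg_left ?_ hC₁)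
    exact Real.rpow_le_rpow_of_nonpos hj0 (by exact_mod_cast hi) (by linarith)
  have hres : ∀ i, j ≤ i → ∀ u : ℕ → ℝ, (∀ k, |u k| ≤ ustar k) →
      ‖y - Gj i u‖ ≤ ‖y‖ + C₁ + C₂ := by
    intro i hi u hu
    have hG := hbound u hu
    have hC := mul_le_of_le_one_right hC₁ hr1
    have hGj := norm_le_norm_sub_add (Gj i u) (G u)
    linarith [norm_sub_le y (Gj i u), herr i hi u hu]
  have hmisfit : ∀ u : ℕ → ℝ, (∀ k, |u k| ≤ ustar k) →
      |‖y - Gj j' u‖ ^ 2 / 2 - ‖y - Gj j u‖ ^ 2 / 2| ≤ (‖y‖ + C₁ + C₂) * (2 * C₁ * r) := by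
    intro u hu
    refine abs_half_norm_sq_sub_le (hres j' hjj' u hu) (hres j le_rfl u hu) ?_
    rw [sub_sub_sub_cancel_left]
    have htri := norm_sub_le_norm_sub_add_norm_sub (Gj j u) (G u) (Gj j' u)
    rw [norm_sub_rev (G u)] at htri
    linarith [herr j le_rfl u hu, herr j' hjj' u hu]
  unfold accept
  rw [← hproj j x hx, ← hproj j z hz]
  refine (abs_min_one_exp_sub_le _ _).trans ?_
  rw [sub_sub_sub_comm]
  refine (abs_sub _ _).trans ?_
  linarith [hmisfit x hx, hmisfit z hz]
end

section
/- Let r > 1, 0 ≤ θ < r, q > 3/(r−θ), and t a real number with 1 + θq < t < rq − 2 (this interval is nonempty because q > 3/(r−θ)). Let (Δ_i)_{i≥0} be square-integrable real random variables with ‖Δ_i‖₂ ≤ C (i ∨ 1)^{−rq/2} for all i, and let N be an ℕ-valued random variable, independent of the Δ_i's, with P(N ≥ 0) = 1 and P(N ≥ i) = i^{−t} for i ≥ 1. Then ∑_{i≤l} ‖Δ_i‖₂ ‖Δ_l‖₂ / P(N ≥ i) < ∞ (so the randomised truncation estimator Z := ∑_{i=0}^N Δ̃_i / P(N ≥ i),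 built from mutually independent copies Δ̃_i of Δ_i independent of N, is unbiased for lim_n E[∑_{i=0}^n Δ_i] with finite variance), and moreover ∑_{i≥2} i^{θq} log(i) · P(N ≥ i) < ∞. -/
open MeasureTheory ProbabilityTheory

/-- A shifted `p`-series: `∑ i, (i ∨ 1)^s` converges for `s < -1`. -/
lemma summable_max_one_rpow {s : ℝ} (hs : s < -1) :
    Summable (fun i : ℕ => (max (i : ℝ) 1) ^ s) := by
  rw [← summable_nat_add_iff 1]
  refine ((summable_nat_add_iff 1).2 (Real.summable_nat_rpow.2 hs)).congr fun i => ?_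
  rw [max_eq_left (by push_cast; linarith [Nat.cast_nonneg (α := ℝ) i])]

/-- `∑ i, i^u log i` converges for `u < -1`. -/
lemma summable_rpow_mul_log {u : ℝ} (hu : u < -1) :
    Summable (fun i : ℕ => (i : ℝ) ^ u * Real.log i) := by
  set ε := (-1 - u) / 2 with hε
  have hε0 : 0 < ε := by linarith
  have hsum : Summable (fun i : ℕ => (i : ℝ) ^ (u + ε) / ε) :=
    (Real.summable_nat_rpow.2 (by linarith)).div_const ε
  refine hsum.of_nonneg_of_le (fun i => ?_) fun i => ?_
  · exact mul_nonneg (by positivity) (Real.log_natCast_nonneg i)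
  · rcases Nat.eq_zero_or_pos i with rfl | hi
    · simp only [Nat.cast_zero, Real.log_zero, mul_zero]
      positivity
    · have hi' : (0 : ℝ) < i := by exact_mod_cast hi
      rw [Real.rpow_add hi', mul_div_assoc]
      gcongr
      exact Real.log_le_rpow_div hi'.le hε0

/-- If `σ i ≤ C (i ∨ 1)^(-a/2)` and `p i = (i ∨ 1)^(-t)` with `0 ≤ t < a - 2`, then
`∑_{i ≤ l} σ i σ l / p i` converges. -/
lemma summable_pair_div {σ p : ℕ → ℝ} {C a t : ℝ} (ht0 : 0 ≤ t) (hta : t < a - 2)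
    (hσ0 : ∀ i, 0 ≤ σ i) (hσ : ∀ i : ℕ, σ i ≤ C * (max (i : ℝ) 1) ^ (-a / 2))
    (hp : ∀ i : ℕ, p i = (max (i : ℝ) 1) ^ (-t)) :
    Summable (fun pr : ℕ × ℕ =>
      if pr.1 ≤ pr.2 then σ pr.1 * σ pr.2 / p pr.1 else 0) := by
  have hs := summable_max_one_rpow (s := (t - a) / 2) (by linarith)
  have hm : ∀ i : ℕ, 0 < max (i : ℝ) 1 := fun i => lt_max_of_lt_right one_pos
  have hp0 : ∀ i, 0 < p i := fun i => by rw [hp]; exact Real.rpow_pos_of_pos (hm i) _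
  have hprod := (hs.mul_of_nonneg hs (fun i => by positivity) fun i => by positivity).mul_left
    (C ^ 2)
  refine hprod.of_nonneg_of_le (fun pr => ?_) fun pr => ?_
  · split_ifs
    · exact div_nonneg (mul_nonneg (hσ0 _) (hσ0 _)) (hp0 _).le
    · exact le_rfl
  · obtain ⟨i, l⟩ := pr
    dsimp only
    split_ifs with hil
    · have hle : max (i : ℝ) 1 ≤ max (l : ℝ) 1 := by gcongr
      have hexp : ∀ k : ℕ, (max (k : ℝ) 1) ^ ((t - a) / 2)
          = (max (k : ℝ) 1) ^ (-a / 2) * (max (k : ℝ) 1) ^ (t / 2) := fun k => by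
        rw [← Real.rpow_add (hm k)]
        ring_nf
      have hinv : (p i)⁻¹ = (max (i : ℝ) 1) ^ (t / 2) * (max (i : ℝ) 1) ^ (t / 2) := by
        rw [hp, Real.rpow_neg (hm i).le, inv_inv, ← Real.rpow_add (hm i), add_halves]
      calc σ i * σ l / p i
          = σ i * σ l * ((max (i : ℝ) 1) ^ (t / 2) * (max (i : ℝ) 1) ^ (t / 2)) := by
            rw [div_eq_mul_inv, hinv]
        _ ≤ (C * (max (i : ℝ) 1) ^ (-a / 2)) * (C * (max (l : ℝ) 1) ^ (-a / 2))
              * ((max (i : ℝ) 1) ^ (t / 2) * (max (l : ℝ) 1) ^ (t / 2)) := by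
            refine mul_le_mul (mul_le_mul (hσ i) (hσ l) (hσ0 l) ((hσ0 i).trans (hσ i)))
              ?_ (by positivity) (mul_nonneg ((hσ0 i).trans (hσ i)) ((hσ0 l).trans (hσ l)))
            gcongr
        _ = C ^ 2 * ((max (i : ℝ) 1) ^ ((t - a) / 2) * (max (l : ℝ) 1) ^ ((t - a) / 2)) := by
            rw [hexp, hexp]
            ring
    · positivity

/-- Quantitative core of the unbiased independence-sampler theorem: with
`‖Δᵢ‖₂ ≤ C (i ∨ 1)^{−rq/2}` and `P(N ≥ i) = i^{−t}`, `1 + θq < t < rq − 2`, both the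
variance pair-sum and the expected-work sum are finite. -/
theorem stmt_12
    {Ω : Type*} [MeasurableSpace Ω] (P : Measure Ω) [IsProbabilityMeasure P]
    (r θ q t : ℝ) (hr : 1 < r) (hθ0 : 0 ≤ θ) (hθr : θ < r)
    (hq : 3 / (r - θ) < q) (ht1 : 1 + θ * q < t) (ht2 : t < r * q - 2)
    (Δ : ℕ → Ω → ℝ) (hΔmeas : ∀ i, Measurable (Δ i))
    (hΔsq : ∀ i, Integrable (fun ω => (Δ i ω) ^ 2) P)
    (C : ℝ)
    (hΔbound : ∀ i : ℕ,
      Real.sqrt (∫ ω, (Δ i ω) ^ 2 ∂P) ≤ C * (max (i : ℝ) 1) ^ (-(r * q) / 2))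
    (N : Ω → ℕ) (hNmeas : Measurable N)
    (hN_indep : Indep (MeasurableSpace.comap N inferInstance)
      (⨆ i, MeasurableSpace.comap (Δ i) inferInstance) P)
    (hNlaw0 : (P {ω | (0 : ℕ) ≤ N ω}).toReal = 1)
    (hNlaw : ∀ i : ℕ, 1 ≤ i → (P {ω | i ≤ N ω}).toReal = (i : ℝ) ^ (-t)) :
    -- the variance pair-sum is finite ...
    Summable (fun pr : ℕ × ℕ =>
      if pr.1 ≤ pr.2 then
        Real.sqrt (∫ ω, (Δ pr.1 ω) ^ 2 ∂P) * Real.sqrt (∫ ω, (Δ pr.2 ω) ^ 2 ∂P)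
          / (P {ω | pr.1 ≤ N ω}).toReal
      else 0) ∧
    -- ... and so is the expected-work sum `∑_{i ≥ 2} i^{θq} log i · P(N ≥ i)`
    Summable (fun i : ℕ =>
      if 2 ≤ i then (i : ℝ) ^ (θ * q) * Real.log i * (P {ω | i ≤ N ω}).toReal else 0) := by
  have hq0 : 0 < q := lt_trans (div_pos three_pos (sub_pos.2 hθr)) hq
  have ht0 : 0 ≤ t := by linarith [mul_nonneg hθ0 hq0.le]
  have hp : ∀ i : ℕ, (P {ω | i ≤ N ω}).toReal = (max (i : ℝ) 1) ^ (-t) := fun i => by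
    rcases Nat.eq_zero_or_pos i with rfl | hi
    · simp
    · rw [hNlaw i hi, max_eq_left (by exact_mod_cast hi)]
  refine ⟨summable_pair_div (σ := fun i => Real.sqrt (∫ ω, (Δ i ω) ^ 2 ∂P))
    (p := fun i => (P {ω | i ≤ N ω}).toReal) ht0 ht2 (fun i => Real.sqrt_nonneg _) hΔbound hp, ?_⟩
  refine (summable_rpow_mul_log (u := θ * q - t) (by linarith)).congr fun i => ?_
  split_ifs with hi
  · have hi' : (0 : ℝ) < i := by exact_mod_cast (by omega : 0 < i)
    rw [hNlaw i (by omega), sub_eq_add_neg, Real.rpow_add hi']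
    ring
  · interval_cases i <;> simp
end

section
/- Let r ∈ (0,1), m a positive integer, θ ≥ 1, a > θ + 1/2, and ε ∈ (0, m(2a−1−2θ)/(2a−1)) (this interval is nonempty since a > θ + 1/2). Let (Δ_i)_{i≥0} be square-integrable real random variables with ‖Δ_i‖₂² ≤ C r^{m i} for all i, let N be an ℕ-valued random variable, independent of the Δ_i's, with P(N ≥ i) = r^{(m−ε)i}, and set j_i := ⌈ r^{2mi/(1−2a)} ⌉. Then ∑_{i≤l} ‖Δ_i‖₂ ‖Δ_l‖₂ / P(N ≥ i) < ∞ (so the randomised truncation estimator Z := ∑_{i=0}^N Δ̃_i / P(N ≥ i), built from mutually independent copies Δ̃_i of Δ_i independent of N, is unbiased for lim_n E[∑_{i=0}^n Δ_i] with finite variance), and moreover ∑_{i=0}^∞ (m i) · j_i^θ · P(N ≥ i) < ∞. -/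
open MeasureTheory ProbabilityTheory

/-- If `u` and `v` are of order `r^{m i}` and `r^{m l}` with `i ≤ l`, then `√u √v` divided by
`r^{(m-ε) i}` is dominated by a product of geometric sequences. -/
lemma sqrt_mul_sqrt_div_rpow_le {r m ε δ C u v : ℝ} (hr0 : 0 < r) (hr1 : r < 1) (hC : 0 ≤ C)
    (hδm : 2 * δ ≤ m) (hδε : 2 * δ ≤ ε) {i l : ℕ} (hil : i ≤ l)
    (hu : u ≤ C * r ^ (m * (i : ℝ))) (hv : v ≤ C * r ^ (m * (l : ℝ))) :
    Real.sqrt u * Real.sqrt v / r ^ ((m - ε) * (i : ℝ)) ≤ C * ((r ^ δ) ^ i * (r ^ δ) ^ l) := by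
  have sqrt_bound : ∀ (w : ℝ) (k : ℕ), w ≤ C * r ^ (m * (k : ℝ)) →
      Real.sqrt w ≤ Real.sqrt C * r ^ (m * (k : ℝ) / 2) := by
    intro w k hw
    refine (Real.sqrt_le_sqrt hw).trans_eq ?_
    rw [Real.sqrt_mul hC, Real.sqrt_eq_rpow (r ^ _), ← Real.rpow_mul hr0.le]
    ring_nf
  have hil' : (i : ℝ) ≤ l := by exact_mod_cast hil
  have hi : (0 : ℝ) ≤ i := i.cast_nonneg
  calc Real.sqrt u * Real.sqrt v / r ^ ((m - ε) * (i : ℝ))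
      ≤ (Real.sqrt C * r ^ (m * (i : ℝ) / 2)) * (Real.sqrt C * r ^ (m * (l : ℝ) / 2))
          / r ^ ((m - ε) * (i : ℝ)) := by
        gcongr
        · exact sqrt_bound u i hu
        · exact sqrt_bound v l hv
    _ = C * r ^ (m * (i : ℝ) / 2 + m * (l : ℝ) / 2 - (m - ε) * (i : ℝ)) := by
        rw [Real.rpow_sub hr0, Real.rpow_add hr0, mul_mul_mul_comm, Real.mul_self_sqrt hC,
          mul_div_assoc]
    _ ≤ C * r ^ (δ * (i : ℝ) + δ * (l : ℝ)) := by
        refine mul_le_mul_of_nonneg_left (Real.rpow_le_rpow_of_exponent_ge hr0 hr1.le ?_) hC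
        nlinarith [mul_nonneg (sub_nonneg.2 hδm) (sub_nonneg.2 hil'),
          mul_nonneg (sub_nonneg.2 hδε) hi]
    _ = C * ((r ^ δ) ^ i * (r ^ δ) ^ l) := by
        rw [Real.rpow_add hr0, Real.rpow_mul hr0.le, Real.rpow_mul hr0.le, Real.rpow_natCast,
          Real.rpow_natCast]

lemma natCeil_rpow_le {x θ : ℝ} (hx : 1 ≤ x) (hθ : 0 ≤ θ) :
    (Nat.ceil x : ℝ) ^ θ ≤ 2 ^ θ * x ^ θ := by
  rw [← Real.mul_rpow zero_le_two (by linarith)]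
  refine Real.rpow_le_rpow (Nat.cast_nonneg _) ?_ hθ
  linarith [Nat.ceil_lt_add_one (zero_le_one.trans hx)]

/-- Quantitative core of the unbiased pCN theorem: with `‖Δᵢ‖₂² ≤ C r^{m i}`,
`P(N ≥ i) = r^{(m−ε)i}` and dimensions `jᵢ = ⌈r^{2mi/(1−2a)}⌉`, both the variance pair-sum
and the expected-work sum `∑ (m i) jᵢ^θ P(N ≥ i)` are finite. -/
theorem stmt_13
    {Ω : Type*} [MeasurableSpace Ω] (P : Measure Ω) [IsProbabilityMeasure P]
    (r : ℝ) (hr0 : 0 < r) (hr1 : r < 1)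
    (m : ℕ) (hm : 0 < m) (θ a : ℝ) (hθ : 1 ≤ θ) (ha : θ + 1 / 2 < a)
    (ε : ℝ) (hε0 : 0 < ε) (hε1 : ε < (m : ℝ) * (2 * a - 1 - 2 * θ) / (2 * a - 1))
    (Δ : ℕ → Ω → ℝ) (hΔmeas : ∀ i, Measurable (Δ i))
    (hΔsq : ∀ i, Integrable (fun ω => (Δ i ω) ^ 2) P)
    (C : ℝ)
    (hΔbound : ∀ i : ℕ, ∫ ω, (Δ i ω) ^ 2 ∂P ≤ C * r ^ (m * i))
    (N : Ω → ℕ) (hNmeas : Measurable N)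
    (hN_indep : Indep (MeasurableSpace.comap N inferInstance)
      (⨆ i, MeasurableSpace.comap (Δ i) inferInstance) P)
    (hNlaw : ∀ i : ℕ, (P {ω | i ≤ N ω}).toReal = r ^ (((m : ℝ) - ε) * (i : ℝ))) :
    -- the variance pair-sum is finite ...
    Summable (fun pr : ℕ × ℕ =>
      if pr.1 ≤ pr.2 then
        Real.sqrt (∫ ω, (Δ pr.1 ω) ^ 2 ∂P) * Real.sqrt (∫ ω, (Δ pr.2 ω) ^ 2 ∂P)
          / (P {ω | pr.1 ≤ N ω}).toReal
      else 0) ∧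
    -- ... and so is the expected-work sum, with `jᵢ = ⌈r^{2mi/(1−2a)}⌉`
    Summable (fun i : ℕ =>
      ((m : ℝ) * i) *
        ((Nat.ceil (r ^ (2 * (m : ℝ) * (i : ℝ) / (1 - 2 * a))) : ℝ) ^ θ) *
        (P {ω | i ≤ N ω}).toReal) := by
  have hmR : (0 : ℝ) < m := by exact_mod_cast hm
  have ha1 : 0 < 2 * a - 1 := by linarith
  constructor
  · have hC : 0 ≤ C := by
      have h := (integral_nonneg fun ω => sq_nonneg (Δ 0 ω)).trans (hΔbound 0)
      simpa using h
    have hbound : ∀ i : ℕ, ∫ ω, (Δ i ω) ^ 2 ∂P ≤ C * r ^ ((m : ℝ) * (i : ℝ)) := by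
      intro i
      refine (hΔbound i).trans_eq ?_
      rw [← Nat.cast_mul, Real.rpow_natCast]
    obtain ⟨δ, hδ0, hδm, hδε⟩ : ∃ δ : ℝ, 0 < δ ∧ 2 * δ ≤ m ∧ 2 * δ ≤ ε :=
      ⟨min (m : ℝ) ε / 2, by positivity, by linarith [min_le_left (m : ℝ) ε],
        by linarith [min_le_right (m : ℝ) ε]⟩
    have hq0 : 0 ≤ r ^ δ := Real.rpow_nonneg hr0.le δ
    have hgeom : Summable fun i : ℕ => (r ^ δ) ^ i :=
      summable_geometric_of_lt_one hq0 (Real.rpow_lt_one hr0.le hr1 hδ0)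
    have hprod : Summable fun pr : ℕ × ℕ => C * ((r ^ δ) ^ pr.1 * (r ^ δ) ^ pr.2) :=
      (hgeom.mul_of_nonneg hgeom (fun _ => by positivity) (fun _ => by positivity)).mul_left C
    refine hprod.of_nonneg_of_le (fun pr => ?_) (fun pr => ?_)
    · split_ifs <;> positivity
    · split_ifs with h
      · rw [hNlaw]
        exact sqrt_mul_sqrt_div_rpow_le hr0 hr1 hC hδm hδε h (hbound _) (hbound _)
      · positivity
  · set κ : ℝ := (m : ℝ) - ε - 2 * m * θ / (2 * a - 1) with hκ
    have hκ0 : 0 < κ := by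
      have h : (m : ℝ) * (2 * a - 1 - 2 * θ) / (2 * a - 1) = m - 2 * m * θ / (2 * a - 1) := by
        field_simp
      rw [h] at hε1
      linarith
    have hq0 : 0 ≤ r ^ κ := Real.rpow_nonneg hr0.le κ
    have hgeom : Summable fun i : ℕ => (i : ℝ) ^ 1 * (r ^ κ) ^ i :=
      summable_pow_mul_geometric_of_norm_lt_one 1
        (by rw [Real.norm_of_nonneg hq0]; exact Real.rpow_lt_one hr0.le hr1 hκ0)
    refine (hgeom.mul_left ((m : ℝ) * 2 ^ θ)).of_nonneg_of_le (fun i => by positivity)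
      (fun i => ?_)
    have hx : 1 ≤ r ^ (2 * (m : ℝ) * (i : ℝ) / (1 - 2 * a)) :=
      Real.one_le_rpow_of_pos_of_le_one_of_nonpos hr0 hr1.le
        (div_nonpos_of_nonneg_of_nonpos (by positivity) (by linarith))
    have hexp : 2 * (m : ℝ) * (i : ℝ) / (1 - 2 * a) * θ + ((m : ℝ) - ε) * i = κ * i := by
      have h : 1 - 2 * a = -(2 * a - 1) := by ring
      rw [hκ, h, div_neg]
      ring
    rw [hNlaw]
    calc (m : ℝ) * i * (Nat.ceil (r ^ (2 * (m : ℝ) * (i : ℝ) / (1 - 2 * a))) : ℝ) ^ θ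
          * r ^ (((m : ℝ) - ε) * (i : ℝ))
        ≤ (m : ℝ) * i * (2 ^ θ * (r ^ (2 * (m : ℝ) * (i : ℝ) / (1 - 2 * a))) ^ θ)
          * r ^ (((m : ℝ) - ε) * (i : ℝ)) := by
          gcongr
          exact natCeil_rpow_le hx (by linarith)
      _ = (m : ℝ) * 2 ^ θ * (i * r ^ (κ * i)) := by
          rw [← hexp, Real.rpow_add hr0, Real.rpow_mul hr0.le _ θ]
          ring
      _ = (m : ℝ) * 2 ^ θ * ((i : ℝ) ^ 1 * (r ^ κ) ^ i) := by
          rw [pow_one, Real.rpow_mul hr0.le, Real.rpow_natCast]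
end

section
/- Let X and H be Hilbert spaces, τ > 0, and define d_τ(x,y) := 1 ∧ (‖x−y‖/τ), V(x) := exp(‖x‖), and the distance-like function d̃(x,y) := ( d_τ(x,y) (1 + V(x) + V(y)) )^{1/2} on X. Suppose f : X → H satisfies ‖f(x) − f(y)‖_H ≤ C ‖x−y‖^{1/4} exp( (‖x‖ ∨ ‖y‖)/8 ) for all x, y ∈ X. Then there exists a constant C′ > 0, depending only on C and τ, such that ‖f(x) − f(y)‖_H ≤ C′ d̃(x,y)^{1/2} for all x, y ∈ X; that is, f is (1/2)-Hölder continuous with respect to d̃. In particular, the identity map f(x) = x and the map f(x) = x ⊗ x (into the Hilbert space of Hilbert–Schmidt operators) satisfy this Hölder condition. -/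
open Real RealInnerProductSpace

/-- The distance-like function `d̃(x,y) = √(d_τ(x,y) (1 + V(x) + V(y)))`, where
`d_τ(x,y) = 1 ∧ ‖x−y‖/τ` and `V(x) = exp ‖x‖`. -/
noncomputable def dtilde {X : Type*} [NormedAddCommGroup X] (τ : ℝ) (x y : X) : ℝ :=
  Real.sqrt (min 1 (‖x - y‖ / τ) * (1 + Real.exp ‖x‖ + Real.exp ‖y‖))

/-- Two points lie within twice the larger of their norms. -/
theorem norm_sub_le_two_mul_max {X : Type*} [NormedAddCommGroup X] (x y : X) :
    ‖x - y‖ ≤ 2 * max ‖x‖ ‖y‖ := by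
  linarith [norm_sub_le x y, le_max_left ‖x‖ ‖y‖, le_max_right ‖x‖ ‖y‖]

theorem pow_le_factorial_mul_exp_half {m : ℝ} (hm : 0 ≤ m) (n : ℕ) :
    m ^ n ≤ 2 ^ n * n.factorial * Real.exp (m / 2) := by
  have h := Real.pow_div_factorial_le_exp (m / 2) (by positivity) n
  have hn : (0 : ℝ) < n.factorial := by exact_mod_cast n.factorial_pos
  rw [div_le_iff₀ hn, div_pow, div_le_iff₀ (by positivity)] at h
  linarith

theorem rpow_quarter_mul_exp {r : ℝ} (hr : 0 ≤ r) (m : ℝ) :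
    r ^ ((1 : ℝ) / 4) * Real.exp (m / 8) = (r * Real.exp (m / 2)) ^ ((1 : ℝ) / 4) := by
  rw [Real.mul_rpow hr (Real.exp_pos _).le, ← Real.exp_mul]
  ring_nf

theorem le_mul_rpow_quarter_mul_exp {a r m K : ℝ} (ha : 0 ≤ a) (hr : 0 ≤ r) (hK : 0 ≤ K)
    (h : a ^ 4 ≤ K * (r * Real.exp (m / 2))) :
    a ≤ K ^ ((1 : ℝ) / 4) * r ^ ((1 : ℝ) / 4) * Real.exp (m / 8) := by
  rw [mul_assoc, rpow_quarter_mul_exp hr, ← Real.mul_rpow hK (by positivity)]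
  calc a = (a ^ 4) ^ ((1 : ℝ) / 4) := by
        rw [← Real.rpow_natCast, ← Real.rpow_mul ha]
        norm_num
    _ ≤ _ := Real.rpow_le_rpow (by positivity) h (by norm_num)

theorem dtilde_rpow_half {X : Type*} [NormedAddCommGroup X] {τ : ℝ} (hτ : 0 < τ) (x y : X) :
    dtilde τ x y ^ ((1 : ℝ) / 2) =
      (min 1 (‖x - y‖ / τ) * (1 + Real.exp ‖x‖ + Real.exp ‖y‖)) ^ ((1 : ℝ) / 4) := by
  have h : 0 ≤ min 1 (‖x - y‖ / τ) * (1 + Real.exp ‖x‖ + Real.exp ‖y‖) := by positivity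
  rw [dtilde, Real.sqrt_eq_rpow, ← Real.rpow_mul h]
  norm_num

theorem norm_sub_mul_exp_le {X : Type*} [NormedAddCommGroup X] {τ : ℝ} (hτ : 0 < τ) (x y : X) :
    ‖x - y‖ * Real.exp (max ‖x‖ ‖y‖ / 2) ≤
      (τ + 4) * (min 1 (‖x - y‖ / τ) * (1 + Real.exp ‖x‖ + Real.exp ‖y‖)) := by
  have hr := norm_nonneg (x - y)
  have hM : 0 ≤ max ‖x‖ ‖y‖ := le_max_of_le_left (norm_nonneg x)
  have hrM := norm_sub_le_two_mul_max x y
  have hS : Real.exp (max ‖x‖ ‖y‖) ≤ 1 + Real.exp ‖x‖ + Real.exp ‖y‖ := by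
    rcases max_cases ‖x‖ ‖y‖ with h | h <;> rw [h.1] <;>
      linarith [Real.exp_pos ‖x‖, Real.exp_pos ‖y‖]
  generalize 1 + Real.exp ‖x‖ + Real.exp ‖y‖ = S at *
  generalize max ‖x‖ ‖y‖ = M at *
  generalize ‖x - y‖ = r at *
  have hS0 : 0 < S := (Real.exp_pos M).trans_le hS
  rcases le_total (r / τ) 1 with h | h
  · rw [min_eq_right h]
    have hMS : Real.exp (M / 2) ≤ S := (Real.exp_le_exp.2 (by linarith)).trans hS
    calc r * Real.exp (M / 2) ≤ r * S := by gcongr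
      _ = τ * (r / τ * S) := by field_simp
      _ ≤ (τ + 4) * (r / τ * S) := by gcongr; linarith
  · rw [min_eq_left h, one_mul]
    have hr4 : r ≤ 4 * Real.exp (M / 2) := by linarith [Real.add_one_le_exp (M / 2)]
    calc r * Real.exp (M / 2) ≤ 4 * Real.exp (M / 2) * Real.exp (M / 2) := by gcongr
      _ = 4 * Real.exp M := by rw [mul_assoc, ← Real.exp_add, add_halves]
      _ ≤ (τ + 4) * S := by gcongr; linarith

/-- The map `x ↦ x ⊗ x` is locally Lipschitz, by the inner product of pure tensors alone. -/
theorem norm_tensor_self_sub_le {X H : Type*} [NormedAddCommGroup X] [InnerProductSpace ℝ X]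
    [NormedAddCommGroup H] [InnerProductSpace ℝ H] {tens : X → X → H}
    (htens : ∀ x y x' y' : X, ⟪tens x y, tens x' y'⟫ = ⟪x, x'⟫ * ⟪y, y'⟫) (x y : X) :
    ‖tens x x - tens y y‖ ≤ (‖x‖ + ‖y‖) * ‖x - y‖ := by
  refine le_of_sq_le_sq ?_ (by positivity)
  rw [mul_pow, norm_sub_sq_real, norm_sub_sq_real, ← real_inner_self_eq_norm_sq (tens x x),
    ← real_inner_self_eq_norm_sq (tens y y), htens, htens, htens,
    real_inner_self_eq_norm_sq x, real_inner_self_eq_norm_sq y]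
  have hc := real_inner_le_norm x y
  generalize ⟪x, y⟫ = c at *
  have hp := norm_nonneg x
  have hq := norm_nonneg y
  generalize ‖x‖ = p at *
  generalize ‖y‖ = q at *
  nlinarith [mul_nonneg (sub_nonneg.2 hc)
    (show 0 ≤ 2 * (p + q) ^ 2 - 2 * (p * q + c) by nlinarith [mul_nonneg hp hq])]

/-- Functions satisfying `‖f(x) − f(y)‖ ≤ C ‖x−y‖^{1/4} exp((‖x‖∨‖y‖)/8)` are `1/2`-Hölder
with respect to `d̃`, with a constant depending only on `C` and `τ`; in particular the
identity map and `x ↦ x ⊗ x` (into Hilbert–Schmidt operators, characterised by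
`⟪x⊗y, x'⊗y'⟫ = ⟪x,x'⟫⟪y,y'⟫`) satisfy this growth condition. -/
theorem stmt_15
    {X : Type*} [NormedAddCommGroup X] [InnerProductSpace ℝ X]
    (C τ : ℝ) (hC : 0 < C) (hτ : 0 < τ) :
    -- main claim: `1/2`-Hölder continuity with respect to `d̃`
    (∃ C' : ℝ, 0 < C' ∧
      ∀ (H : Type) (_ : NormedAddCommGroup H),
      ∀ f : X → H,
        (∀ x y : X, ‖f x - f y‖ ≤
          C * ‖x - y‖ ^ ((1 : ℝ) / 4) * Real.exp (max ‖x‖ ‖y‖ / 8)) →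
        ∀ x y : X, ‖f x - f y‖ ≤ C' * dtilde τ x y ^ ((1 : ℝ) / 2)) ∧
    -- the identity map satisfies the growth condition
    (∃ C₀ : ℝ, 0 < C₀ ∧ ∀ x y : X,
      ‖x - y‖ ≤ C₀ * ‖x - y‖ ^ ((1 : ℝ) / 4) * Real.exp (max ‖x‖ ‖y‖ / 8)) ∧
    -- and so does `x ↦ x ⊗ x` into any Hilbert space realising the tensor inner product
    (∀ (H : Type) (_ : NormedAddCommGroup H) (_ : InnerProductSpace ℝ H),
      ∀ tens : X → X → H,
        (∀ x y x' y' : X, ⟪tens x y, tens x' y'⟫ = ⟪x, x'⟫ * ⟪y, y'⟫) →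
        ∃ C₀ : ℝ, 0 < C₀ ∧ ∀ x y : X,
          ‖tens x x - tens y y‖ ≤
            C₀ * ‖x - y‖ ^ ((1 : ℝ) / 4) * Real.exp (max ‖x‖ ‖y‖ / 8)) := by
  refine ⟨⟨C * (τ + 4) ^ ((1 : ℝ) / 4), by positivity, ?_⟩,
    ⟨(384 : ℝ) ^ ((1 : ℝ) / 4), by positivity, ?_⟩, ?_⟩
  · intro H _ f hf x y
    refine (hf x y).trans ?_
    rw [mul_assoc, mul_assoc, rpow_quarter_mul_exp (norm_nonneg _), dtilde_rpow_half hτ,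
      ← Real.mul_rpow (by positivity) (by positivity)]
    exact mul_le_mul_of_nonneg_left
      (Real.rpow_le_rpow (by positivity) (norm_sub_mul_exp_le hτ x y) (by norm_num)) hC.le
  · intro x y
    refine le_mul_rpow_quarter_mul_exp (norm_nonneg _) (norm_nonneg _) (by norm_num) ?_
    have hM : 0 ≤ max ‖x‖ ‖y‖ := le_max_of_le_left (norm_nonneg x)
    have h3 := pow_le_factorial_mul_exp_half hM 3
    norm_num [Nat.factorial] at h3
    calc ‖x - y‖ ^ 4 = ‖x - y‖ * ‖x - y‖ ^ 3 := by ring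
      _ ≤ ‖x - y‖ * (2 * max ‖x‖ ‖y‖) ^ 3 := by gcongr; exact norm_sub_le_two_mul_max x y
      _ = ‖x - y‖ * (8 * max ‖x‖ ‖y‖ ^ 3) := by ring
      _ ≤ ‖x - y‖ * (8 * (48 * Real.exp (max ‖x‖ ‖y‖ / 2))) := by gcongr
      _ = 384 * (‖x - y‖ * Real.exp (max ‖x‖ ‖y‖ / 2)) := by ring
  · intro H _ _ tens htens
    refine ⟨(128 * 645120 : ℝ) ^ ((1 : ℝ) / 4), by positivity, fun x y => ?_⟩
    refine le_mul_rpow_quarter_mul_exp (norm_nonneg _) (norm_nonneg _) (by norm_num) ?_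
    have hM : 0 ≤ max ‖x‖ ‖y‖ := le_max_of_le_left (norm_nonneg x)
    have h7 := pow_le_factorial_mul_exp_half hM 7
    norm_num [Nat.factorial] at h7
    have hxy : ‖x‖ + ‖y‖ ≤ 2 * max ‖x‖ ‖y‖ := by
      linarith [le_max_left ‖x‖ ‖y‖, le_max_right ‖x‖ ‖y‖]
    calc ‖tens x x - tens y y‖ ^ 4 ≤ ((‖x‖ + ‖y‖) * ‖x - y‖) ^ 4 := by
          gcongr
          exact norm_tensor_self_sub_le htens x y
      _ = (‖x‖ + ‖y‖) ^ 4 * (‖x - y‖ * ‖x - y‖ ^ 3) := by ring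
      _ ≤ (2 * max ‖x‖ ‖y‖) ^ 4 * (‖x - y‖ * (2 * max ‖x‖ ‖y‖) ^ 3) := by
          gcongr
          exact norm_sub_le_two_mul_max x y
      _ = 128 * ‖x - y‖ * max ‖x‖ ‖y‖ ^ 7 := by ring
      _ ≤ 128 * ‖x - y‖ * (645120 * Real.exp (max ‖x‖ ‖y‖ / 2)) := by gcongr
      _ = 128 * 645120 * (‖x - y‖ * Real.exp (max ‖x‖ ‖y‖ / 2)) := by ring
end

section
/- Let 0 < u_min ≤ u_max and let H : [0,1] → ℝ be continuous. For a continuous function u : [0,1] → ℝ with u_min ≤ u(s) ≤ u_max for all s ∈ [0,1], define C_u := − (∫₀¹ H(s)/u(s) ds) / (∫₀¹ 1/u(s) ds) and p(u)(x) := − ∫₀ˣ (H(s) + C_u)/u(s) ds for x ∈ [0,1]. Then there exists a constant K > 0, depending only on u_min, u_max and sup_{s}|H(s)|, such that for all such u and ũ: sup_{x ∈ [0,1]} | p(u)(x) − p(ũ)(x) | ≤ K ( ∫₀¹ |u(s) − ũ(s)|² ds )^{1/2}. -/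
open MeasureTheory

/-- The constant `C_u = −(∫₀¹ H/u)/(∫₀¹ 1/u)` in the explicit solution of the 1-d elliptic
problem `−(u p′)′ = h`, `p(0) = p(1) = 0`, where `H` is an antiderivative of `h`. -/
noncomputable def Cconst (H u : ℝ → ℝ) : ℝ :=
  -(∫ s in (0 : ℝ)..1, H s / u s) / (∫ s in (0 : ℝ)..1, 1 / u s)

/-- The explicit solution `p(u)(x) = −∫₀ˣ (H(s) + C_u)/u(s) ds`. -/
noncomputable def psol (H u : ℝ → ℝ) (x : ℝ) : ℝ :=
  -∫ s in (0 : ℝ)..x, (H s + Cconst H u) / u s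

open Set intervalIntegral

/-- A continuous function on `[0,1]` is interval integrable on `[0,x]` for `x ∈ [0,1]`. -/
lemma ContinuousOn.intervalIntegrable_zero_of_mem_Icc {f : ℝ → ℝ} (hf : ContinuousOn f (Icc 0 1))
    {x : ℝ} (hx : x ∈ Icc (0 : ℝ) 1) : IntervalIntegrable f volume 0 x :=
  ContinuousOn.intervalIntegrable <| hf.mono <| by
    rw [uIcc_of_le hx.1]
    exact Icc_subset_Icc_right hx.2

/-- Cauchy–Schwarz on `[0,1]` against the constant function `1`. -/
lemma integral_abs_le_sqrt_integral_sq {f : ℝ → ℝ} (hf : ContinuousOn f (Icc 0 1)) :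
    ∫ s in (0 : ℝ)..1, |f s| ≤ Real.sqrt (∫ s in (0 : ℝ)..1, f s ^ 2) := by
  have h1 : (1 : ℝ) ∈ Icc (0 : ℝ) 1 := by simp
  apply Real.le_sqrt_of_sq_le
  set D := ∫ s in (0 : ℝ)..1, |f s| with hD
  have hnonneg : 0 ≤ ∫ s in (0 : ℝ)..1, (|f s| - D) ^ 2 :=
    integral_nonneg zero_le_one fun s _ => sq_nonneg _
  have hexpand : ∫ s in (0 : ℝ)..1, (|f s| - D) ^ 2
      = (∫ s in (0 : ℝ)..1, f s ^ 2) - 2 * D * D + D ^ 2 := by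
    have hsq : IntervalIntegrable (fun s => f s ^ 2) volume 0 1 :=
      (hf.pow 2).intervalIntegrable_zero_of_mem_Icc h1
    have habs := (hf.abs.const_mul (2 * D)).intervalIntegrable_zero_of_mem_Icc h1
    calc ∫ s in (0 : ℝ)..1, (|f s| - D) ^ 2
        = ∫ s in (0 : ℝ)..1, (f s ^ 2 - 2 * D * |f s| + D ^ 2) := by
          congr 1 with s
          rw [← sq_abs (f s)]
          ring
      _ = _ := by
          rw [integral_add (hsq.sub habs) (by simp), integral_sub hsq habs,
            intervalIntegral.integral_const_mul, ← hD]
          simp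
  linarith

/-- On `[0,x] ⊆ [0,1]`, the integral of a function dominated by `c |f|` is bounded by
`c ‖f‖_{L²(0,1)}`. -/
lemma abs_integral_le_mul_sqrt_integral_sq {f g : ℝ → ℝ} {c x : ℝ} (hc : 0 ≤ c)
    (hf : ContinuousOn f (Icc 0 1)) (hg : ContinuousOn g (Icc 0 1))
    (hgf : ∀ s ∈ Icc (0 : ℝ) 1, |g s| ≤ c * |f s|) (hx : x ∈ Icc (0 : ℝ) 1) :
    |∫ s in (0 : ℝ)..x, g s| ≤ c * Real.sqrt (∫ s in (0 : ℝ)..1, f s ^ 2) := by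
  have h1 : (1 : ℝ) ∈ Icc (0 : ℝ) 1 := by simp
  have hcf := hf.abs.const_mul c
  calc |∫ s in (0 : ℝ)..x, g s| ≤ ∫ s in (0 : ℝ)..x, |g s| :=
        abs_integral_le_integral_abs hx.1
    _ ≤ ∫ s in (0 : ℝ)..x, c * |f s| :=
        integral_mono_on hx.1 (hg.abs.intervalIntegrable_zero_of_mem_Icc hx)
          (hcf.intervalIntegrable_zero_of_mem_Icc hx)
          fun s hs => hgf s ⟨hs.1, hs.2.trans hx.2⟩
    _ ≤ ∫ s in (0 : ℝ)..1, c * |f s| :=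
        integral_mono_interval le_rfl hx.1 hx.2
          (Filter.Eventually.of_forall fun s => mul_nonneg hc (abs_nonneg _))
          (hcf.intervalIntegrable_zero_of_mem_Icc h1)
    _ = c * ∫ s in (0 : ℝ)..1, |f s| := intervalIntegral.integral_const_mul _ _
    _ ≤ _ := mul_le_mul_of_nonneg_left (integral_abs_le_sqrt_integral_sq hf) hc

lemma integral_one_div_pos {u : ℝ → ℝ} (hu : ContinuousOn u (Icc 0 1))
    (hpos : ∀ s ∈ Icc (0 : ℝ) 1, 0 < u s) : 0 < ∫ s in (0 : ℝ)..1, 1 / u s :=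
  intervalIntegral_pos_of_pos_on
    ((continuousOn_const.div hu fun s hs => (hpos s hs).ne').intervalIntegrable_zero_of_mem_Icc
      (by simp))
    (fun s hs => one_div_pos.2 (hpos s (Ioo_subset_Icc_self hs))) one_pos

lemma abs_Cconst_le {H u : ℝ → ℝ} {M : ℝ} (hH : ContinuousOn H (Icc 0 1))
    (hHM : ∀ s ∈ Icc (0 : ℝ) 1, |H s| ≤ M) (hu : ContinuousOn u (Icc 0 1))
    (hpos : ∀ s ∈ Icc (0 : ℝ) 1, 0 < u s) : |Cconst H u| ≤ M := by
  have h1 : (1 : ℝ) ∈ Icc (0 : ℝ) 1 := by simp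
  have hne : ∀ s ∈ Icc (0 : ℝ) 1, u s ≠ 0 := fun s hs => (hpos s hs).ne'
  have hB := integral_one_div_pos hu hpos
  rw [Cconst, abs_div, abs_neg, abs_of_pos hB, div_le_iff₀ hB,
    ← intervalIntegral.integral_const_mul]
  refine (abs_integral_le_integral_abs zero_le_one).trans (integral_mono_on zero_le_one
    ((hH.div hu hne).abs.intervalIntegrable_zero_of_mem_Icc h1)
    (((continuousOn_const.div hu hne).const_mul M).intervalIntegrable_zero_of_mem_Icc h1)
    fun s hs => ?_)
  rw [abs_div, abs_of_pos (hpos s hs), mul_one_div]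
  exact div_le_div_of_nonneg_right (hHM s hs) (hpos s hs).le

/-- The boundary condition `p(u)(1) = 0`. -/
lemma psol_one {H u : ℝ → ℝ} (hH : ContinuousOn H (Icc 0 1)) (hu : ContinuousOn u (Icc 0 1))
    (hpos : ∀ s ∈ Icc (0 : ℝ) 1, 0 < u s) : psol H u 1 = 0 := by
  have h1 : (1 : ℝ) ∈ Icc (0 : ℝ) 1 := by simp
  have hne : ∀ s ∈ Icc (0 : ℝ) 1, u s ≠ 0 := fun s hs => (hpos s hs).ne'
  have hB := (integral_one_div_pos hu hpos).ne'
  have hsplit : ∀ s, (H s + Cconst H u) / u s = H s / u s + Cconst H u * (1 / u s) :=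
    fun s => by ring
  have hHu : ContinuousOn (fun s => H s / u s) (Icc 0 1) := hH.div hu hne
  have hui : ContinuousOn (fun s => 1 / u s) (Icc 0 1) := continuousOn_const.div hu hne
  simp_rw [psol, hsplit]
  rw [integral_add (hHu.intervalIntegrable_zero_of_mem_Icc h1)
    ((hui.const_mul _).intervalIntegrable_zero_of_mem_Icc h1),
    intervalIntegral.integral_const_mul, Cconst, div_mul_cancel₀ _ hB]
  ring

lemma psol_sub_psol {H u v : ℝ → ℝ} (hH : ContinuousOn H (Icc 0 1))
    (hu : ContinuousOn u (Icc 0 1)) (hv : ContinuousOn v (Icc 0 1))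
    (hu0 : ∀ s ∈ Icc (0 : ℝ) 1, 0 < u s) (hv0 : ∀ s ∈ Icc (0 : ℝ) 1, 0 < v s)
    {x : ℝ} (hx : x ∈ Icc (0 : ℝ) 1) :
    psol H u x - psol H v x
      = -(∫ s in (0 : ℝ)..x, (H s + Cconst H v) * (1 / u s - 1 / v s))
        - (Cconst H u - Cconst H v) * ∫ s in (0 : ℝ)..x, 1 / u s := by
  have hune : ∀ s ∈ Icc (0 : ℝ) 1, u s ≠ 0 := fun s hs => (hu0 s hs).ne'
  have hvne : ∀ s ∈ Icc (0 : ℝ) 1, v s ≠ 0 := fun s hs => (hv0 s hs).ne'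
  have hui : ContinuousOn (fun s => 1 / u s) (Icc 0 1) := continuousOn_const.div hu hune
  have hvi : ContinuousOn (fun s => 1 / v s) (Icc 0 1) := continuousOn_const.div hv hvne
  have hF : ContinuousOn (fun s => (H s + Cconst H v) * (1 / u s - 1 / v s)) (Icc 0 1) :=
    (hH.add continuousOn_const).mul (hui.sub hvi)
  have hV : ContinuousOn (fun s => (H s + Cconst H v) / v s) (Icc 0 1) :=
    (hH.add continuousOn_const).div hv hvne
  have hW := hui.const_mul (Cconst H u - Cconst H v)
  have hsplit : ∀ s, (H s + Cconst H u) / u s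
      = (H s + Cconst H v) * (1 / u s - 1 / v s) + (Cconst H u - Cconst H v) * (1 / u s)
        + (H s + Cconst H v) / v s := fun s => by ring
  have hFi := hF.intervalIntegrable_zero_of_mem_Icc hx
  have hWi := hW.intervalIntegrable_zero_of_mem_Icc hx
  rw [psol, psol]
  simp_rw [hsplit]
  rw [integral_add (hFi.add hWi) (hV.intervalIntegrable_zero_of_mem_Icc hx),
    integral_add hFi hWi, intervalIntegral.integral_const_mul]
  ring

/-- Lipschitz continuity in `L²(0,1)` of the solution map `u ↦ p(u)` of the 1-d elliptic
problem, uniformly over diffusion coefficients bounded between `umin` and `umax`, with a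
constant depending only on `umin`, `umax` and the sup bound `M` on `|H|`. -/
theorem stmt_18 (umin umax M : ℝ) (humin : 0 < umin) (h : umin ≤ umax) (hM : 0 ≤ M) :
    ∃ K : ℝ, 0 < K ∧
      ∀ H : ℝ → ℝ, ContinuousOn H (Set.Icc 0 1) →
        (∀ s ∈ Set.Icc (0 : ℝ) 1, |H s| ≤ M) →
      ∀ u v : ℝ → ℝ, ContinuousOn u (Set.Icc 0 1) → ContinuousOn v (Set.Icc 0 1) →
        (∀ s ∈ Set.Icc (0 : ℝ) 1, umin ≤ u s ∧ u s ≤ umax) →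
        (∀ s ∈ Set.Icc (0 : ℝ) 1, umin ≤ v s ∧ v s ≤ umax) →
      ∀ x ∈ Set.Icc (0 : ℝ) 1,
        |psol H u x - psol H v x| ≤ K * Real.sqrt (∫ s in (0 : ℝ)..1, (u s - v s) ^ 2) := by
  refine ⟨4 * M / umin ^ 2 + 1, by positivity, ?_⟩
  intro H hH hHM u v hu hv hub hvb x hx
  have h1 : (1 : ℝ) ∈ Icc (0 : ℝ) 1 := by simp
  have hu0 : ∀ s ∈ Icc (0 : ℝ) 1, 0 < u s := fun s hs => humin.trans_le (hub s hs).1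
  have hv0 : ∀ s ∈ Icc (0 : ℝ) 1, 0 < v s := fun s hs => humin.trans_le (hvb s hs).1
  have hui : ContinuousOn (fun s => 1 / u s) (Icc 0 1) :=
    continuousOn_const.div hu fun s hs => (hu0 s hs).ne'
  have hvi : ContinuousOn (fun s => 1 / v s) (Icc 0 1) :=
    continuousOn_const.div hv fun s hs => (hv0 s hs).ne'
  set R := Real.sqrt (∫ s in (0 : ℝ)..1, (u s - v s) ^ 2)
  have hR : 0 ≤ R := Real.sqrt_nonneg _
  have hC := abs_Cconst_le hH hHM hv hv0
  have hpointwise : ∀ s ∈ Icc (0 : ℝ) 1,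
      |(H s + Cconst H v) * (1 / u s - 1 / v s)| ≤ 2 * M / umin ^ 2 * |u s - v s| := by
    intro s hs
    have hus := hu0 s hs
    have hvs := hv0 s hs
    have hsum : |H s + Cconst H v| ≤ 2 * M :=
      (abs_add_le _ _).trans (by linarith [hHM s hs])
    have hprod : umin ^ 2 ≤ u s * v s := by
      rw [sq]
      exact mul_le_mul (hub s hs).1 (hvb s hs).1 humin.le hus.le
    have hdiff : |1 / u s - 1 / v s| ≤ |u s - v s| / umin ^ 2 := by
      rw [div_sub_div _ _ hus.ne' hvs.ne', abs_div, abs_of_pos (mul_pos hus hvs), one_mul,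
        mul_one, abs_sub_comm]
      exact div_le_div_of_nonneg_left (abs_nonneg _) (by positivity) hprod
    rw [abs_mul]
    calc _ ≤ 2 * M * (|u s - v s| / umin ^ 2) :=
          mul_le_mul hsum hdiff (abs_nonneg _) (by positivity)
      _ = _ := by ring
  have hF : ∀ y ∈ Icc (0 : ℝ) 1,
      |∫ s in (0 : ℝ)..y, (H s + Cconst H v) * (1 / u s - 1 / v s)|
        ≤ 2 * M / umin ^ 2 * R := fun y hy =>
    abs_integral_le_mul_sqrt_integral_sq (by positivity) (hu.sub hv)
      ((hH.add continuousOn_const).mul (hui.sub hvi)) hpointwise hy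
  have hinv : ∀ s ∈ Icc (0 : ℝ) 1, 0 ≤ 1 / u s := fun s hs => (one_div_pos.2 (hu0 s hs)).le
  have hW0 : 0 ≤ ∫ s in (0 : ℝ)..x, 1 / u s :=
    integral_nonneg hx.1 fun s hs => hinv s ⟨hs.1, hs.2.trans hx.2⟩
  have hW : ∫ s in (0 : ℝ)..x, 1 / u s ≤ ∫ s in (0 : ℝ)..1, 1 / u s :=
    integral_mono_interval le_rfl hx.1 hx.2
      ((ae_restrict_iff' measurableSet_Ioc).2
        (Filter.Eventually.of_forall fun s hs => hinv s (Ioc_subset_Icc_self hs)))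
      (hui.intervalIntegrable_zero_of_mem_Icc h1)
  -- The boundary condition at `1` controls the difference of the constants.
  have hone := psol_sub_psol hH hu hv hu0 hv0 h1
  rw [psol_one hH hu hu0, psol_one hH hv hv0] at hone
  have hconst : |(Cconst H u - Cconst H v) * ∫ s in (0 : ℝ)..x, 1 / u s|
      ≤ 2 * M / umin ^ 2 * R := by
    refine le_trans ?_ (hF 1 h1)
    rw [show (∫ s in (0 : ℝ)..1, (H s + Cconst H v) * (1 / u s - 1 / v s))
      = -((Cconst H u - Cconst H v) * ∫ s in (0 : ℝ)..1, 1 / u s) by linarith, abs_neg,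
      abs_mul, abs_mul, abs_of_nonneg hW0, abs_of_nonneg (hW0.trans hW)]
    exact mul_le_mul_of_nonneg_left hW (abs_nonneg _)
  rw [psol_sub_psol hH hu hv hu0 hv0 hx]
  calc _ ≤ 2 * M / umin ^ 2 * R + 2 * M / umin ^ 2 * R := by
        refine (abs_sub _ _).trans (add_le_add ?_ hconst)
        rw [abs_neg]
        exact hF x hx
    _ ≤ (4 * M / umin ^ 2 + 1) * R := by
        rw [show 4 * M / umin ^ 2 = 2 * M / umin ^ 2 + 2 * M / umin ^ 2 by ring]
        linarith
end
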